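/- arXiv:2601.16201 — 15 statements merged into one kernel-verified Lean document; each statement's English description precedes it below -/
import Mathlib

section
/- Let A be a ring, let T be a simple right A-module, let I be an infinite index set, and let M = ⊕_{i∈I} T_i be a direct sum of copies T_i ≅ T of T. Then M is a generalized bassian right A-module but M is not a bassian right A-module. -/
open MulOpposite DirectSum

/-- A module `M` over a ring `R` is *bassian* if for every submodule `N` of `M`,
the existence of an injective `R`-linear map `M → M/N` implies `N = 0`.
(A right `A`-module is formalized as a module over the opposite ring `Aᵐᵒᵖ`.) -/
def IsBassian (R : Type*) [Ring R] (M : Type*) [AddCommGroup M] [Module R M] : Prop :=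
  ∀ N : Submodule R M, (∃ f : M →ₗ[R] M ⧸ N, Function.Injective f) → N = ⊥

/-- A module `M` over a ring `R` is *generalized bassian* if for every submodule `N` of `M`,
the existence of an injective `R`-linear map `M → M/N` implies that `N` is a direct summand
of `M`. -/
def IsGeneralizedBassian (R : Type*) [Ring R] (M : Type*) [AddCommGroup M] [Module R M] : Prop :=
  ∀ N : Submodule R M, (∃ f : M →ₗ[R] M ⧸ N, Function.Injective f) →
    ∃ N' : Submodule R M, IsCompl N N'


theorem exists_injective_not_surjective_of_infinite (I : Type*) [Infinite I] :
    ∃ f : I → I, Function.Injective f ∧ ¬ Function.Surjective f := by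
  obtain ⟨e⟩ : Nonempty (Option I ≃ I) := by
    rw [← Cardinal.eq, Cardinal.mk_option]
    exact Cardinal.add_one_eq (Cardinal.aleph0_le_mk I)
  refine ⟨fun i => e (some i), e.injective.comp (Option.some_injective I), fun h => ?_⟩
  obtain ⟨i, hi⟩ := h (e none)
  exact Option.some_ne_none i (e.injective hi)

/-- Over a semisimple module every submodule is a direct summand. -/
theorem IsSemisimpleModule.isGeneralizedBassian (R M : Type*) [Ring R] [AddCommGroup M]
    [Module R M] [IsSemisimpleModule R M] : IsGeneralizedBassian R M :=
  fun N _ => exists_isCompl N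

/-- A module with a non-injective split epimorphism onto itself is not bassian. -/
theorem not_isBassian_of_comp_eq_id {R M : Type*} [Ring R] [AddCommGroup M] [Module R M]
    {g s : M →ₗ[R] M} (hgs : g ∘ₗ s = LinearMap.id) (hg : LinearMap.ker g ≠ ⊥) :
    ¬ IsBassian R M := by
  intro h
  have hsurj : Function.Surjective g := fun x => ⟨s x, LinearMap.congr_fun hgs x⟩
  exact hg (h _ ⟨(g.quotKerEquivOfSurjective hsurj).symm.toLinearMap,
    (g.quotKerEquivOfSurjective hsurj).symm.injective⟩)

theorem not_isBassian_directSum (R T I : Type*) [Ring R] [AddCommGroup T] [Module R T]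
    [Nontrivial T] [Infinite I] : ¬ IsBassian R (⨁ _ : I, T) := by
  classical
  obtain ⟨f, hf, hns⟩ := exists_injective_not_surjective_of_infinite I
  obtain ⟨j, hj⟩ := not_forall.mp hns
  obtain ⟨t, ht⟩ := exists_ne (0 : T)
  let g : (⨁ _ : I, T) →ₗ[R] ⨁ _ : I, T :=
    { toFun := DFinsupp.comapDomain f hf
      map_add' := DFinsupp.comapDomain_add f hf
      map_smul' := DFinsupp.comapDomain_smul f hf }
  let s : (⨁ _ : I, T) →ₗ[R] ⨁ _ : I, T :=
    DirectSum.toModule R I _ fun i => DirectSum.lof R I (fun _ => T) (f i)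
  refine not_isBassian_of_comp_eq_id (g := g) (s := s) ?_ ?_
  · refine DirectSum.linearMap_ext R fun i => LinearMap.ext fun x => ?_
    have hs : s (DirectSum.lof R I (fun _ => T) i x) =
        DirectSum.lof R I (fun _ => T) (f i) x := DirectSum.toModule_lof ..
    simp only [LinearMap.comp_apply, LinearMap.id_apply, hs]
    exact DFinsupp.comapDomain_single (β := fun _ => T) f hf i x
  · refine (Submodule.ne_bot_iff _).mpr ⟨DirectSum.lof R I (fun _ => T) j t, ?_, ?_⟩
    · refine LinearMap.mem_ker.mpr (DFinsupp.ext fun i => ?_)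
      exact DFinsupp.single_eq_of_ne fun h => hj ⟨i, h⟩
    · exact fun h => ht (DFinsupp.single_eq_zero.mp h)

/-- A direct sum of infinitely many copies of a simple right `A`-module is
generalized bassian but not bassian. -/
theorem stmt0 {A : Type*} [Ring A] (T : Type*) [AddCommGroup T] [Module Aᵐᵒᵖ T]
    [IsSimpleModule Aᵐᵒᵖ T] (I : Type*) [Infinite I] :
    IsGeneralizedBassian Aᵐᵒᵖ (⨁ _ : I, T) ∧ ¬ IsBassian Aᵐᵒᵖ (⨁ _ : I, T) := by
  have : IsSemisimpleModule Aᵐᵒᵖ (⨁ _ : I, T) :=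
    inferInstanceAs (IsSemisimpleModule Aᵐᵒᵖ (Π₀ _ : I, T))
  have : Nontrivial T := IsSimpleModule.nontrivial Aᵐᵒᵖ T
  exact ⟨IsSemisimpleModule.isGeneralizedBassian _ _, not_isBassian_directSum _ T I⟩
end

section
/- Let A be a ring and let M be a generalized bassian right A-module with a direct sum decomposition M = X ⊕ Y into submodules X and Y. Then X is a generalized bassian right A-module. -/
open MulOpposite DirectSum

/-- An injection `X → X ⧸ N` of a direct summand `X` of `M` extends, by the identity on a
complement, to an injection of `M` into its quotient by the image of `N`. -/
theorem exists_injective_quotient_map_subtype {R M : Type*} [Ring R] [AddCommGroup M] [Module R M]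
    {X Y : Submodule R M} (hXY : IsCompl X Y) (N : Submodule R X)
    (f : X →ₗ[R] X ⧸ N) (hf : Function.Injective f) :
    ∃ g : M →ₗ[R] M ⧸ N.map X.subtype, Function.Injective g := by
  let p := X.projectionOnto Y hXY
  let q := Y.projectionOnto X hXY.symm
  let i : X ⧸ N →ₗ[R] M ⧸ N.map X.subtype :=
    N.mapQ (N.map X.subtype) X.subtype (Submodule.le_comap_map _ _)
  refine ⟨i ∘ₗ f ∘ₗ p + (N.map X.subtype).mkQ ∘ₗ Y.subtype ∘ₗ q, ?_⟩
  rw [injective_iff_map_eq_zero]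
  intro m hm
  obtain ⟨x, hx⟩ := N.mkQ_surjective (f (p m))
  have hmem : (x : M) + q m ∈ N.map X.subtype := by
    rw [← Submodule.Quotient.mk_eq_zero, Submodule.Quotient.mk_add]
    simpa [← hx, i] using hm
  obtain ⟨n, hn, hnx⟩ := hmem
  have hnx' : (n : M) = x + q m := hnx
  have hqX : (q m : M) ∈ X := by
    rw [← sub_eq_of_eq_add' hnx']
    exact X.sub_mem n.2 x.2
  have hq : (q m : M) = 0 := Submodule.disjoint_def.mp hXY.disjoint _ hqX (q m).2
  have hxn : n = x := Subtype.ext (by simpa [hq] using hnx')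
  have hp : p m = 0 := by
    apply hf
    rw [map_zero, ← hx, ← hxn]
    exact (Submodule.Quotient.mk_eq_zero N).mpr hn
  have hmY : m ∈ Y := (Submodule.projectionOnto_apply_eq_zero_iff hXY).mp hp
  have hmX : m ∈ X :=
    (Submodule.projectionOnto_apply_eq_zero_iff hXY.symm).mp (Subtype.ext hq)
  exact Submodule.disjoint_def.mp hXY.disjoint m hmX hmY

/-- If the image in `M` of a submodule `N` of `X` is complemented in `M`, then `N` is complemented
in `X`. -/
theorem isCompl_comap_subtype_of_isCompl_map {R M : Type*} [Ring R] [AddCommGroup M] [Module R M]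
    {X : Submodule R M} {N : Submodule R X} {K : Submodule R M}
    (h : IsCompl (N.map X.subtype) K) : IsCompl N (K.comap X.subtype) := by
  refine ⟨Submodule.disjoint_def.mpr fun x hxN hxK => Subtype.ext ?_,
    codisjoint_iff.mpr (eq_top_iff.mpr fun x _ => ?_)⟩
  · exact Submodule.disjoint_def.mp h.disjoint _ (Submodule.mem_map_of_mem hxN) hxK
  · have hx : (x : M) ∈ N.map X.subtype ⊔ K := h.sup_eq_top ▸ Submodule.mem_top
    obtain ⟨_, ⟨n, hn, rfl⟩, k, hk, hnk⟩ := Submodule.mem_sup.mp hx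
    refine Submodule.mem_sup.mpr ⟨n, hn, x - n, ?_, add_sub_cancel _ _⟩
    have hxk : ((x - n : X) : M) = k := sub_eq_of_eq_add' hnk.symm
    rwa [Submodule.mem_comap, Submodule.subtype_apply, hxk]

/-- A direct summand of a generalized bassian module is generalized bassian. -/
theorem stmt1 {A M : Type*} [Ring A] [AddCommGroup M] [Module Aᵐᵒᵖ M]
    (hM : IsGeneralizedBassian Aᵐᵒᵖ M) (X Y : Submodule Aᵐᵒᵖ M) (hXY : IsCompl X Y) :
    IsGeneralizedBassian Aᵐᵒᵖ X := by
  rintro N ⟨f, hf⟩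
  obtain ⟨K, hK⟩ := hM _ (exists_injective_quotient_map_subtype hXY N f hf)
  exact ⟨_, isCompl_comap_subtype_of_isCompl_map hK⟩
end

section
/- Let A be a ring and let M be a bassian right A-module with a direct sum decomposition M = X ⊕ Y into submodules X and Y. Then X is a bassian right A-module. -/
open MulOpposite DirectSum

/-- If the product of two modules is linearly equivalent to a bassian module, then its first factor
is bassian. -/
theorem IsBassian.of_prod_linearEquiv {R M X Y : Type*} [Ring R] [AddCommGroup M] [Module R M]
    [AddCommGroup X] [Module R X] [AddCommGroup Y] [Module R Y]
    (hM : IsBassian R M) (e : M ≃ₗ[R] X × Y) : IsBassian R X := by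
  rintro N ⟨f, hf⟩
  let h : M →ₗ[R] (X ⧸ N) × Y := N.mkQ.prodMap LinearMap.id ∘ₗ e.toLinearMap
  have h_surj : Function.Surjective h :=
    (Function.Surjective.prodMap N.mkQ_surjective Function.surjective_id).comp e.surjective
  let g : M →ₗ[R] M ⧸ LinearMap.ker h :=
    (h.quotKerEquivOfSurjective h_surj).symm.toLinearMap ∘ₗ
      f.prodMap LinearMap.id ∘ₗ e.toLinearMap
  have hg : Function.Injective g :=
    (h.quotKerEquivOfSurjective h_surj).symm.injective.comp
      ((Function.Injective.prodMap hf Function.injective_id).comp e.injective)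
  have h_ker := hM _ ⟨g, hg⟩
  refine (Submodule.eq_bot_iff N).2 fun x hx => ?_
  have hx_mem : e.symm (x, 0) ∈ LinearMap.ker h := by
    simp [h, hx]
  rw [h_ker, Submodule.mem_bot, LinearEquiv.map_eq_zero_iff] at hx_mem
  exact congrArg Prod.fst hx_mem

/-- A direct summand of a bassian module is bassian. -/
theorem stmt2 {A M : Type*} [Ring A] [AddCommGroup M] [Module Aᵐᵒᵖ M]
    (hM : IsBassian Aᵐᵒᵖ M) (X Y : Submodule Aᵐᵒᵖ M) (hXY : IsCompl X Y) :
    IsBassian Aᵐᵒᵖ X := by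
  exact hM.of_prod_linearEquiv (Submodule.prodEquivOfIsCompl X Y hXY).symm
end

section
/- Let A be a ring and let M be a generalized bassian right A-module such that for every simple submodule T of M, the T-homogeneous component of the socle of M (the sum of all simple submodules of M isomorphic to T) is a finitely generated submodule. Then M is a bassian right A-module. -/
open MulOpposite DirectSum

section

variable {R M : Type*} [Ring R] [AddCommGroup M] [Module R M]

/-- In a generalized bassian module, a submodule `N` such that `M` embeds in `M` with image
disjoint from `N` is semisimple: all its submodules are direct summands of `M`. -/
theorem IsGeneralizedBassian.isSemisimpleModule_of_disjoint_range
    (hM : IsGeneralizedBassian R M) {N : Submodule R M} {g : M →ₗ[R] M}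
    (hg : Function.Injective g) (hN : Disjoint N (LinearMap.range g)) :
    IsSemisimpleModule R N := by
  rw [isSemisimpleModule_iff, Submodule.mapIic N |>.complementedLattice_iff]
  refine ⟨fun ⟨K, hK⟩ ↦ ?_⟩
  have hKN : K ≤ N := hK
  obtain ⟨K', hK'⟩ := hM K ⟨K.mkQ ∘ₗ g, by
    rw [← LinearMap.ker_eq_bot, LinearMap.ker_eq_bot']
    intro m hm
    have hmK : g m ∈ K := by simpa using hm
    exact hg ((Submodule.disjoint_def.1 hN (g m) (hKN hmK) ⟨m, rfl⟩).trans (map_zero g).symm)⟩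
  refine ⟨⟨K' ⊓ N, Set.mem_Iic.2 inf_le_right⟩, ?_, ?_⟩
  · rw [disjoint_iff, Subtype.ext_iff]
    change K ⊓ (K' ⊓ N) = ⊥
    rw [← inf_assoc, hK'.inf_eq_bot, bot_inf_eq]
  · rw [codisjoint_iff, Subtype.ext_iff]
    change K ⊔ K' ⊓ N = N
    rw [← sup_inf_assoc_of_le K' hKN, hK'.sup_eq_top, top_inf_eq]

/-- An injective endomorphism whose range is disjoint from a simple submodule `T` forces the
isotypic component of `T` to be infinitely generated. -/
theorem not_fg_isotypicComponent_of_disjoint_range {T : Submodule R M} [IsSimpleModule R T]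
    {g : M →ₗ[R] M} (hg : Function.Injective g) (hT : Disjoint T (LinearMap.range g)) :
    ¬ (isotypicComponent R M T).FG := by
  intro hfg
  have : Module.Finite R (isotypicComponent R M T) := Module.Finite.iff_fg.2 hfg
  have hmap := LinearMap.le_comap_isotypicComponent (S := T) g
  have hsurj := IsArtinian.surjective_of_injective_endomorphism (g.restrict hmap)
    (fun x y h ↦ Subtype.ext (hg (congrArg Subtype.val h)))
  have hle : T ≤ LinearMap.range g := fun t ht ↦ by
    obtain ⟨y, hy⟩ := hsurj ⟨t, T.le_isotypicComponent ht⟩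
    exact ⟨y, congrArg Subtype.val hy⟩
  exact (isSimpleModule_iff_isAtom.1 ‹_›).1 (hT.eq_bot_of_le hle)

end

/-- If `M` is generalized bassian and every homogeneous component of the socle of `M`
is finitely generated, then `M` is bassian. -/
theorem stmt3 {A M : Type*} [Ring A] [AddCommGroup M] [Module Aᵐᵒᵖ M]
    (hM : IsGeneralizedBassian Aᵐᵒᵖ M)
    (hsoc : ∀ T : Submodule Aᵐᵒᵖ M, IsSimpleModule Aᵐᵒᵖ ↥T →
      (sSup {S : Submodule Aᵐᵒᵖ M |
        IsSimpleModule Aᵐᵒᵖ ↥S ∧ Nonempty (↥S ≃ₗ[Aᵐᵒᵖ] ↥T)}).FG) :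
    IsBassian Aᵐᵒᵖ M := by
  rintro N ⟨f, hf⟩
  obtain ⟨N', hN'⟩ := hM N ⟨f, hf⟩
  let e := Submodule.quotientEquivOfIsCompl N N' hN'
  let g : M →ₗ[Aᵐᵒᵖ] M := N'.subtype ∘ₗ e.toLinearMap ∘ₗ f
  have hg : Function.Injective g := N'.subtype_injective.comp (e.injective.comp hf)
  have hdisj : Disjoint N (LinearMap.range g) := by
    refine hN'.disjoint.mono_right ?_
    rintro _ ⟨m, rfl⟩
    exact (e (f m)).2
  have := hM.isSemisimpleModule_of_disjoint_range hg hdisj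
  obtain rfl | ⟨T, hTN, hT⟩ := IsSemisimpleModule.eq_bot_or_exists_simple_le N
  · rfl
  have hset : {S : Submodule Aᵐᵒᵖ M | IsSimpleModule Aᵐᵒᵖ S ∧ Nonempty (S ≃ₗ[Aᵐᵒᵖ] T)} =
      {S : Submodule Aᵐᵒᵖ M | Nonempty (S ≃ₗ[Aᵐᵒᵖ] T)} :=
    Set.ext fun S ↦ ⟨And.right, fun ⟨i⟩ ↦ ⟨.congr i, ⟨i⟩⟩⟩
  have hfg := hsoc T hT
  rw [hset] at hfg
  exact absurd hfg (not_fg_isotypicComponent_of_disjoint_range hg (hdisj.mono_left hTN))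
end

section
/- Let A be a ring and let M be a generalized bassian right A-module that has no simple submodules (i.e., M has zero socle). Then M is a bassian right A-module. -/
open MulOpposite DirectSum

/-- If `N` has a complement and `M` embeds into `M ⧸ N`, then `M` embeds into `M ⧸ X` for every
`X ≤ N`. -/
theorem exists_injective_quotient_of_le {R M : Type*} [Ring R] [AddCommGroup M] [Module R M]
    {N N' X : Submodule R M} (hN : IsCompl N N') (hX : X ≤ N)
    (hf : ∃ f : M →ₗ[R] M ⧸ N, Function.Injective f) :
    ∃ g : M →ₗ[R] M ⧸ X, Function.Injective g := by
  obtain ⟨f, hf⟩ := hf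
  have hinj : Function.Injective (X.mkQ ∘ₗ N'.subtype) := by
    rw [← LinearMap.ker_eq_bot, LinearMap.ker_comp, Submodule.ker_mkQ,
      ← Submodule.disjoint_iff_comap_eq_bot]
    exact (hN.disjoint.mono_left hX).symm
  exact ⟨(X.mkQ ∘ₗ N'.subtype) ∘ₗ (N.quotientEquivOfIsCompl N' hN).toLinearMap ∘ₗ f,
    hinj.comp ((N.quotientEquivOfIsCompl N' hN).injective.comp hf)⟩

/-- A submodule all of whose submodules are direct summands of the ambient module is semisimple. -/
theorem isSemisimpleModule_of_forall_le_exists_isCompl {R M : Type*} [Ring R] [AddCommGroup M]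
    [Module R M] {N : Submodule R M} (h : ∀ X ≤ N, ∃ C : Submodule R M, IsCompl X C) :
    IsSemisimpleModule R N := by
  have : ComplementedLattice (Submodule R N) := ⟨fun Y ↦ by
    obtain ⟨C, hC⟩ := h (Y.map N.subtype) (Submodule.map_subtype_le N Y)
    refine ⟨C.comap N.subtype, ?_, ?_⟩
    · rw [Submodule.disjoint_def]
      intro y hy hyC
      exact Subtype.ext (Submodule.disjoint_def.mp hC.disjoint y ⟨y, hy, rfl⟩ hyC)
    · rw [codisjoint_iff, eq_top_iff]
      intro n _
      obtain ⟨_, ⟨y, hy, rfl⟩, c, hc, hyc⟩ :=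
        Submodule.mem_sup.mp (hC.sup_eq_top ▸ Submodule.mem_top : (n : M) ∈ Y.map N.subtype ⊔ C)
      refine Submodule.mem_sup.mpr ⟨y, hy, n - y, ?_, add_sub_cancel _ _⟩
      have : (n : M) - y = c := by simp [← hyc]
      simpa [this] using hc⟩
  exact ⟨⟩

/-- A generalized bassian module with zero socle (no simple submodules) is bassian. -/
theorem stmt4 {A M : Type*} [Ring A] [AddCommGroup M] [Module Aᵐᵒᵖ M]
    (hM : IsGeneralizedBassian Aᵐᵒᵖ M)
    (hsoc : ∀ T : Submodule Aᵐᵒᵖ M, ¬ IsSimpleModule Aᵐᵒᵖ ↥T) :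
    IsBassian Aᵐᵒᵖ M := by
  intro N hf
  obtain ⟨N', hN⟩ := hM N hf
  have : IsSemisimpleModule Aᵐᵒᵖ N := isSemisimpleModule_of_forall_le_exists_isCompl
    fun X hX ↦ hM X (exists_injective_quotient_of_le hN hX hf)
  by_contra hbot
  have : Nontrivial N := Submodule.nontrivial_iff_ne_bot.mpr hbot
  obtain ⟨T, hT⟩ := IsSemisimpleModule.exists_simple_submodule Aᵐᵒᵖ N
  exact hsoc (T.map N.subtype) (IsSimpleModule.congr (N := T) (N.equivSubtypeMap T).symm)
end

section
/- Let A be a ring and let M be a generalized bassian right A-module such that there is no injective A-module homomorphism from M into any proper direct summand of M (i.e., for every submodule D of M with D ≠ M which is a direct summand of M, there is no injective A-module homomorphism from M to D). Then M is a bassian right A-module. -/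
open MulOpposite DirectSum

/-- If `M` is generalized bassian and there is no injective homomorphism from `M` into
any proper direct summand of `M`, then `M` is bassian. -/
theorem stmt5 {A M : Type*} [Ring A] [AddCommGroup M] [Module Aᵐᵒᵖ M]
    (hM : IsGeneralizedBassian Aᵐᵒᵖ M)
    (h : ∀ D : Submodule Aᵐᵒᵖ M, D ≠ ⊤ → (∃ D' : Submodule Aᵐᵒᵖ M, IsCompl D D') →
      ¬ ∃ f : M →ₗ[Aᵐᵒᵖ] ↥D, Function.Injective f) :
    IsBassian Aᵐᵒᵖ M := by
  rintro N ⟨f, hf⟩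
  obtain ⟨N', hN⟩ := hM N ⟨f, hf⟩
  have htop : N' = ⊤ := by
    by_contra hne
    let e := Submodule.quotientEquivOfIsCompl N N' hN
    exact h N' hne ⟨N, hN.symm⟩ ⟨e.toLinearMap ∘ₗ f, e.injective.comp hf⟩
  subst htop
  exact eq_bot_of_isCompl_top hN
end

section
/- Let A be a ring and let M be a generalized bassian right A-module such that every injective A-module endomorphism of M is an automorphism of M (i.e., every injective endomorphism of M is surjective). Then M is a bassian right A-module. -/
open MulOpposite DirectSum

/-- If `M` is generalized bassian and every injective endomorphism of `M` is an
automorphism, then `M` is bassian. -/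
theorem stmt7 {A M : Type*} [Ring A] [AddCommGroup M] [Module Aᵐᵒᵖ M]
    (hM : IsGeneralizedBassian Aᵐᵒᵖ M)
    (h : ∀ f : M →ₗ[Aᵐᵒᵖ] M, Function.Injective f → Function.Surjective f) :
    IsBassian Aᵐᵒᵖ M := by
  rintro N ⟨f, hf⟩
  obtain ⟨N', hc⟩ := hM N ⟨f, hf⟩
  let e := N.quotientEquivOfIsCompl N' hc
  have hs := h (N'.subtype ∘ₗ e.toLinearMap ∘ₗ f)
    (N'.injective_subtype.comp (e.injective.comp hf))
  have htop : N' = ⊤ := by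
    refine eq_top_iff.2 fun x _ => ?_
    obtain ⟨y, rfl⟩ := hs x
    exact (e (f y)).2
  subst htop
  exact hc.disjoint.eq_bot_of_le le_top
end

section
/- Let A be a ring and let S be a simple right A-module that is not singular (i.e., Sing S ≠ S). Then S is a non-singular module (Sing S = 0), and there exists a minimal right ideal S' of A (a minimal element among the nonzero right ideals of A) such that S' is a direct summand of the right A-module A, S' is non-singular, and S' is isomorphic to S as a right A-module. -/
open MulOpposite DirectSum

/-- A submodule `N` of `M` is *essential* if it intersects every nonzero submodule
of `M` nontrivially. -/
def IsEssentialSubmodule {R M : Type*} [Ring R] [AddCommGroup M] [Module R M]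
    (N : Submodule R M) : Prop :=
  ∀ Y : Submodule R M, Y ≠ ⊥ → N ⊓ Y ≠ ⊥

/-- The right annihilator of an element `m` of a right `A`-module `M`
(i.e. a module over `Aᵐᵒᵖ`), as a right ideal of `A` (i.e. an `Aᵐᵒᵖ`-submodule of `A`). -/
def rightAnnihilator (A : Type*) [Ring A] {M : Type*} [AddCommGroup M] [Module Aᵐᵒᵖ M]
    (m : M) : Submodule Aᵐᵒᵖ A where
  carrier := {a : A | op a • m = 0}
  add_mem' := by
    intro a b ha hb
    simp only [Set.mem_setOf_eq] at *
    rw [op_add, add_smul, ha, hb, add_zero]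
  zero_mem' := by simp
  smul_mem' := by
    intro c a ha
    simp only [Set.mem_setOf_eq] at *
    have : op (c • a) = c * op a := by
      induction c using MulOpposite.rec' with
      | h x => rw [op_smul_eq_mul]; rfl
    rw [this, mul_smul, ha, smul_zero]

/-- The singular set `Sing M` of a right `A`-module `M`: the set of all `m ∈ M` whose right
annihilator is an essential right ideal of `A`. -/
def singularSet (A : Type*) [Ring A] (M : Type*) [AddCommGroup M] [Module Aᵐᵒᵖ M] : Set M :=
  {m : M | IsEssentialSubmodule (rightAnnihilator A m)}

/-- The orbit map `a ↦ m a` from `A` to a right `A`-module `M`. -/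
def rightOrbitMap (A : Type*) [Ring A] {M : Type*} [AddCommGroup M] [Module Aᵐᵒᵖ M]
    (m : M) : A →ₗ[Aᵐᵒᵖ] M where
  toFun a := op a • m
  map_add' a b := by rw [op_add, add_smul]
  map_smul' c a := by
    rw [RingHom.id_apply, smul_smul]
    rfl

/-- Left multiplication by `a`, as an endomorphism of the right `A`-module `A`. -/
def leftMulRightLinear {A : Type*} [Ring A] (a : A) : A →ₗ[Aᵐᵒᵖ] A where
  toFun x := a * x
  map_add' x y := mul_add a x y
  map_smul' c x := mul_smul_comm c a x

theorem ker_rightOrbitMap {A : Type*} [Ring A] {M : Type*} [AddCommGroup M] [Module Aᵐᵒᵖ M]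
    (m : M) : LinearMap.ker (rightOrbitMap A m) = rightAnnihilator A m := rfl

theorem rightOrbitMap_surjective {A : Type*} [Ring A] {S : Type*} [AddCommGroup S]
    [Module Aᵐᵒᵖ S] [IsSimpleModule Aᵐᵒᵖ S] {m : S} (hm : m ≠ 0) :
    Function.Surjective (rightOrbitMap A m) :=
  LinearMap.surjective_of_ne_zero fun h => hm <| by
    simpa [rightOrbitMap] using LinearMap.congr_fun h (1 : A)

theorem zero_mem_singularSet (A : Type*) [Ring A] (M : Type*) [AddCommGroup M]
    [Module Aᵐᵒᵖ M] : (0 : M) ∈ singularSet A M := by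
  have h : rightAnnihilator A (0 : M) = ⊤ := by
    ext a
    simp [rightAnnihilator]
  intro Y hY
  rwa [h, top_inf_eq]

theorem notMem_singularSet_iff {A : Type*} [Ring A] {M : Type*} [AddCommGroup M]
    [Module Aᵐᵒᵖ M] {m : M} : m ∉ singularSet A M ↔
      ∃ Y : Submodule Aᵐᵒᵖ A, Y ≠ ⊥ ∧ Disjoint (rightAnnihilator A m) Y := by
  simp [singularSet, IsEssentialSubmodule, disjoint_iff]

/-- In a simple module, one element outside the singular submodule forces
the singular submodule to vanish. -/
theorem singularSet_eq_zero_of_notMem {A : Type*} [Ring A] {S : Type*} [AddCommGroup S]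
    [Module Aᵐᵒᵖ S] [IsSimpleModule Aᵐᵒᵖ S] {m : S} (hm : m ∉ singularSet A S) :
    singularSet A S = {0} := by
  refine Set.Subset.antisymm (fun n hn => ?_)
    (Set.singleton_subset_iff.2 (zero_mem_singularSet A S))
  by_contra hn0
  obtain ⟨Y, hY, hdisj⟩ := notMem_singularSet_iff.1 hm
  obtain ⟨a, rfl⟩ := rightOrbitMap_surjective (A := A) (m := n) hn0 m
  have key : ∀ y ∈ Y, op (a * y) • n = 0 → y = 0 := fun y hy h =>
    (Submodule.disjoint_def.1 hdisj) y (by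
      change op y • op a • n = 0
      rwa [smul_smul, ← op_mul]) hy
  refine notMem_singularSet_iff.2 ⟨Y.map (leftMulRightLinear a), ?_, ?_⟩ hn
  · obtain ⟨y, hy, hy0⟩ := Y.ne_bot_iff.1 hY
    refine (Submodule.ne_bot_iff _).2 ⟨a * y, ⟨y, hy, rfl⟩, fun h => hy0 (key y hy ?_)⟩
    rw [h, op_zero, zero_smul]
  · refine Submodule.disjoint_def.2 ?_
    rintro _ h ⟨y, hy, rfl⟩
    rw [key y hy h, map_zero]

theorem mem_singularSet_map_iff {A : Type*} [Ring A] {M N : Type*} [AddCommGroup M]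
    [Module Aᵐᵒᵖ M] [AddCommGroup N] [Module Aᵐᵒᵖ N] (e : M ≃ₗ[Aᵐᵒᵖ] N) (m : M) :
    e m ∈ singularSet A N ↔ m ∈ singularSet A M := by
  have h : rightAnnihilator A (e m) = rightAnnihilator A m := by
    ext a
    simp [rightAnnihilator, ← map_smul]
  simp only [singularSet, Set.mem_ofPred_eq, h]

theorem singularSet_eq_zero_of_equiv {A : Type*} [Ring A] {M N : Type*} [AddCommGroup M]
    [Module Aᵐᵒᵖ M] [AddCommGroup N] [Module Aᵐᵒᵖ N] (e : M ≃ₗ[Aᵐᵒᵖ] N)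
    (h : singularSet A N = {0}) : singularSet A M = {0} := by
  ext m
  rw [← mem_singularSet_map_iff e, h]
  simp

/-- If `S` is a simple right `A`-module that is not singular, then `S` is non-singular
and is isomorphic to a non-singular minimal right ideal `S'` of `A` which is a direct
summand of `A`. -/
theorem stmt8 {A : Type*} [Ring A] (S : Type*) [AddCommGroup S] [Module Aᵐᵒᵖ S]
    [IsSimpleModule Aᵐᵒᵖ S] (hS : singularSet A S ≠ Set.univ) :
    singularSet A S = {0} ∧
    ∃ S' : Submodule Aᵐᵒᵖ A, IsAtom S' ∧ (∃ C : Submodule Aᵐᵒᵖ A, IsCompl S' C) ∧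
      singularSet A ↥S' = {0} ∧ Nonempty (↥S' ≃ₗ[Aᵐᵒᵖ] S) := by
  obtain ⟨m, hm⟩ := (Set.ne_univ_iff_exists_notMem _).1 hS
  have hsing := singularSet_eq_zero_of_notMem hm
  obtain ⟨Y, hY, hdisj⟩ := notMem_singularSet_iff.1 hm
  rw [← ker_rightOrbitMap] at hdisj
  let f : Y →ₗ[Aᵐᵒᵖ] S := (rightOrbitMap A m).domRestrict Y
  have hinj : Function.Injective f := by
    refine (injective_iff_map_eq_zero f).2 fun y hy => Subtype.ext ?_
    exact Submodule.disjoint_def.1 hdisj y hy y.2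
  have hsurj : Function.Surjective f := by
    refine LinearMap.surjective_of_ne_zero fun h => ?_
    obtain ⟨y, hy, hy0⟩ := Y.ne_bot_iff.1 hY
    have h0 : (⟨y, hy⟩ : Y) = 0 := hinj (by rw [h]; rfl)
    exact hy0 (congrArg Subtype.val h0)
  let e : Y ≃ₗ[Aᵐᵒᵖ] S := LinearEquiv.ofBijective f ⟨hinj, hsurj⟩
  refine ⟨hsing, Y, isSimpleModule_iff_isAtom.1 (IsSimpleModule.congr e),
    ⟨LinearMap.ker (rightOrbitMap A m), hdisj.symm, ?_⟩,
    singularSet_eq_zero_of_equiv e hsing, ⟨e⟩⟩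
  refine codisjoint_iff.2 (eq_top_iff.2 fun a _ => ?_)
  obtain ⟨y, hy⟩ := hsurj (rightOrbitMap A m a)
  refine Submodule.mem_sup.2 ⟨y, y.2, a - y, ?_, add_sub_cancel _ _⟩
  rw [LinearMap.mem_ker, map_sub, sub_eq_zero]
  exact hy.symm
end

section
/- Let A be a prime ring which is right finite-dimensional (the right A-module A contains no infinite direct sums of nonzero right ideals), and suppose A has a simple right A-module S that is not singular (i.e., Sing S ≠ S). Then A is a simple artinian ring. -/
open MulOpposite DirectSum

/-- A simple module is artinian. -/
theorem IsSimpleModule.isArtinian (R M : Type*) [Ring R] [AddCommGroup M] [Module R M]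
    [IsSimpleModule R M] : IsArtinian R M := inferInstance

/-- A sequence of submodules is independent as soon as each term is disjoint from a submodule
containing all later terms. -/
theorem Submodule.iSupIndep_of_disjoint_antitone {R M : Type*} [Ring R] [AddCommGroup M]
    [Module R M] {K N : ℕ → Submodule R M} (hK : Antitone K) (hNK : ∀ n, N n ≤ K n)
    (hdisj : ∀ n, Disjoint (K (n + 1)) (N n)) : iSupIndep N := by
  rw [iSupIndep_iff_finsetSum_eq_zero_imp_eq_zero]
  intro s
  induction s using Finset.induction_on_min with
  | empty => simp
  | insert n s hlt ih =>
    intro v hv hsum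
    have hn : n ∉ s := fun h => (hlt n h).false
    rw [Finset.sum_insert hn] at hsum
    have hmem : ∑ i ∈ s, v i ∈ K (n + 1) := Submodule.sum_mem _ fun i hi =>
      hK (hlt i hi) (hNK i (hv i (Finset.mem_insert_of_mem hi)))
    have hvn : v n = 0 := by
      refine Submodule.disjoint_def.mp (hdisj n) _ ?_ (hv n (Finset.mem_insert_self n s))
      rw [eq_neg_of_add_eq_zero_left hsum]
      exact neg_mem hmem
    rw [hvn, zero_add] at hsum
    intro i hi
    obtain rfl | hi := Finset.mem_insert.mp hi
    · exact hvn
    · exact ih v (fun j hj => hv j (Finset.mem_insert_of_mem hj)) hsum i hi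

/-- The elementwise form of primeness. -/
theorem exists_mul_mul_ne_zero_of_prime {A : Type*} [Ring A]
    (hprime : ∀ B C : TwoSidedIdeal A, B ≠ ⊥ → C ≠ ⊥ → ∃ b ∈ B, ∃ c ∈ C, b * c ≠ 0)
    {a b : A} (ha : a ≠ 0) (hb : b ≠ 0) : ∃ r, a * r * b ≠ 0 := by
  by_contra! h
  have span_ne_bot {x : A} (hx : x ≠ 0) : TwoSidedIdeal.span {x} ≠ ⊥ := fun he => hx <| by
    have : x ∈ TwoSidedIdeal.span {x} := TwoSidedIdeal.subset_span rfl
    rwa [he, TwoSidedIdeal.mem_bot] at this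
  have left : ∀ t ∈ TwoSidedIdeal.span {a}, ∀ r, t * r * b = 0 := by
    let T : TwoSidedIdeal A := .mk' {t | ∀ r, t * r * b = 0} (by simp)
      (fun hx hy r => by simp [add_mul, hx r, hy r]) (fun hx r => by simp [hx r])
      (fun {x y} hy r => by simp [mul_assoc x, hy r])
      (fun {x y} hx r => by rw [mul_assoc x]; exact hx _)
    have : TwoSidedIdeal.span {a} ≤ T := TwoSidedIdeal.span_le.mpr <| by
      simpa [T] using h
    intro t ht
    simpa [T] using this ht
  obtain ⟨t, ht, u, hu, htu⟩ := hprime _ _ (span_ne_bot ha) (span_ne_bot hb)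
  let U : TwoSidedIdeal A := .mk' {u | ∀ r, t * r * u = 0} (by simp)
    (fun hx hy r => by simp [mul_add, hx r, hy r]) (fun hx r => by simp [hx r])
    (fun {x y} hy r => by rw [← mul_assoc, mul_assoc t]; exact hy _)
    (fun {x y} hx r => by rw [← mul_assoc, hx r, zero_mul])
  have : TwoSidedIdeal.span {b} ≤ U := TwoSidedIdeal.span_le.mpr <| by
    simpa [U] using left t ht
  have hut : ∀ r, t * r * u = 0 := by simpa [U] using this hu
  exact htu (by simpa using hut 1)

/-- A ring with a simple right module that is not singular has a minimal right ideal. -/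
theorem exists_isSimpleModule_submodule_of_singularSet_ne_univ {A : Type*} [Ring A]
    (S : Type*) [AddCommGroup S] [Module Aᵐᵒᵖ S] [IsSimpleModule Aᵐᵒᵖ S]
    (hS : singularSet A S ≠ Set.univ) :
    ∃ Y : Submodule Aᵐᵒᵖ A, IsSimpleModule Aᵐᵒᵖ Y := by
  obtain ⟨m, hm⟩ := (Set.ne_univ_iff_exists_notMem _).mp hS
  simp only [singularSet, IsEssentialSubmodule, Set.mem_ofPred_eq, not_forall, not_not] at hm
  obtain ⟨Y, hY, hdisj⟩ := hm
  let f : Y →ₗ[Aᵐᵒᵖ] S :=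
    { toFun := fun y => op (y : A) • m
      map_add' := fun x y => by simp [add_smul]
      map_smul' := fun c y => by
        induction c using MulOpposite.rec' with
        | h c => simp [mul_smul] }
  have hf : Function.Injective f := by
    rw [injective_iff_map_eq_zero]
    intro y hy
    have : (y : A) ∈ rightAnnihilator A m ⊓ Y := ⟨hy, y.2⟩
    rw [hdisj] at this
    exact Subtype.ext this
  have : Nontrivial Y := Submodule.nontrivial_iff_ne_bot.mpr hY
  have hrange : LinearMap.range f = ⊤ := by
    refine (eq_bot_or_eq_top _).resolve_left fun h => ?_
    obtain ⟨y, hy⟩ := exists_ne (0 : Y)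
    exact hy (hf (by simp [LinearMap.range_eq_bot.mp h]))
  exact ⟨Y, IsSimpleModule.congr <|
    LinearEquiv.ofBijective f ⟨hf, LinearMap.range_eq_top.mp hrange⟩⟩

/-- Left multiplication by an element that does not annihilate a minimal right ideal is injective
on it. -/
theorem eq_zero_of_mul_eq_zero_of_isSimpleModule {A : Type*} [Ring A] {Y : Submodule Aᵐᵒᵖ A}
    [IsSimpleModule Aᵐᵒᵖ Y] {a z t : A} (hz : z ∈ Y) (haz : a * z ≠ 0) (ht : t ∈ Y)
    (hat : a * t = 0) : t = 0 := by
  obtain h | h := ((LinearMap.mulLeft Aᵐᵒᵖ a).comp Y.subtype).injective_or_eq_zero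
  · exact congrArg Subtype.val ((injective_iff_map_eq_zero _).mp h ⟨t, ht⟩ hat)
  · exact absurd (DFunLike.congr_fun h ⟨z, hz⟩) haz

/-- In a prime ring with no infinite independent families of right ideals, a minimal right ideal
contains finitely many elements with zero common right annihilator. -/
theorem exists_finset_iInf_ker_mulLeft_eq_bot {A : Type u} [Ring A]
    (hprime : ∀ B C : TwoSidedIdeal A, B ≠ ⊥ → C ≠ ⊥ → ∃ b ∈ B, ∃ c ∈ C, b * c ≠ 0)
    (hfd : ∀ (ι : Type u) (f : ι → Submodule Aᵐᵒᵖ A),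
      iSupIndep f → (∀ i, f i ≠ ⊥) → Finite ι)
    (Y : Submodule Aᵐᵒᵖ A) [IsSimpleModule Aᵐᵒᵖ Y] :
    ∃ F : Finset Y, ⨅ y ∈ F, LinearMap.ker (LinearMap.mulLeft Aᵐᵒᵖ (y : A)) = ⊥ := by
  classical
  by_contra! hne
  let K (F : Finset Y) : Submodule Aᵐᵒᵖ A :=
    ⨅ y ∈ F, LinearMap.ker (LinearMap.mulLeft Aᵐᵒᵖ (y : A))
  have hKmem (F : Finset Y) (a : A) : a ∈ K F ↔ ∀ y ∈ F, (y : A) * a = 0 := by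
    simp [K, Submodule.mem_iInf]
  have : Nontrivial Y := IsSimpleModule.nontrivial Aᵐᵒᵖ Y
  obtain ⟨⟨y₀, hy₀Y⟩, hy₀⟩ := exists_ne (0 : Y)
  replace hy₀ : y₀ ≠ 0 := fun h => hy₀ (Subtype.ext h)
  have step (F : Finset Y) : ∃ (y : Y) (N : Submodule Aᵐᵒᵖ A),
      N ≠ ⊥ ∧ N ≤ K F ∧ Disjoint (K (insert y F)) N := by
    obtain ⟨k, hk, hk0⟩ := Submodule.exists_mem_ne_zero_of_ne_bot (hne F)
    obtain ⟨r, hr⟩ := exists_mul_mul_ne_zero_of_prime hprime hk0 hy₀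
    obtain ⟨q, hq⟩ := exists_mul_mul_ne_zero_of_prime hprime hy₀ hr
    have hkr : k * r ∈ K F := (K F).smul_mem (op r) hk
    refine ⟨⟨y₀ * q, Y.smul_mem (op q) hy₀Y⟩, Y.map (LinearMap.mulLeft Aᵐᵒᵖ (k * r)), ?_, ?_, ?_⟩
    · exact (Submodule.ne_bot_iff _).mpr ⟨_, Submodule.mem_map_of_mem hy₀Y, hr⟩
    · rintro _ ⟨t, -, rfl⟩
      exact (K F).smul_mem (op t) hkr
    · rw [Submodule.disjoint_def]
      rintro _ h ⟨t, ht, rfl⟩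
      have h' := (hKmem _ _).mp h _ (Finset.mem_insert_self _ _)
      have : t = 0 := eq_zero_of_mul_eq_zero_of_isSimpleModule (a := y₀ * q * (k * r)) hy₀Y
        (by rwa [mul_assoc]) ht (by rwa [mul_assoc])
      simp [this]
  choose y N hN hNK hdisj using step
  let F (n : ℕ) : Finset Y := Nat.rec ∅ (fun _ F => insert (y F) F) n
  have hK : Antitone fun n => K (F n) := antitone_nat_of_succ_le fun n a ha =>
    (hKmem _ _).mpr fun z hz => (hKmem _ _).mp ha z (Finset.mem_insert_of_mem hz)
  have hind : iSupIndep fun n => N (F n) :=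
    Submodule.iSupIndep_of_disjoint_antitone hK (fun n => hNK (F n)) fun n => hdisj (F n)
  have : Finite (ULift.{u} ℕ) :=
    hfd (ULift.{u} ℕ) (fun n => N (F n.down)) (hind.comp ULift.down_injective) fun n => hN _
  exact not_finite (ULift.{u} ℕ)

/-- A prime ring that is semisimple as a right module over itself is simple. -/
theorem isSimpleRing_of_prime_of_isSemisimpleModule {A : Type*} [Ring A] [Nontrivial A]
    (hprime : ∀ B C : TwoSidedIdeal A, B ≠ ⊥ → C ≠ ⊥ → ∃ b ∈ B, ∃ c ∈ C, b * c ≠ 0)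
    [IsSemisimpleModule Aᵐᵒᵖ A] : IsSimpleRing A := by
  rw [isSimpleRing_iff_isTwoSided_imp]
  refine ⟨inferInstance, fun I hI => ?_⟩
  let I' : Submodule Aᵐᵒᵖ A :=
    { I.toAddSubmonoid with smul_mem' := fun c x hx => I.mul_mem_right c.unop hx }
  obtain ⟨J, hJ⟩ := exists_isCompl I'
  by_contra! h
  obtain ⟨i, hi, hi0⟩ := Submodule.exists_mem_ne_zero_of_ne_bot h.1
  have hJ0 : J ≠ ⊥ := by
    rintro rfl
    refine h.2 ((Ideal.eq_top_iff_one I).mpr ?_)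
    have : (1 : A) ∈ I' := by rw [eq_top_of_isCompl_bot hJ]; trivial
    exact this
  obtain ⟨j, hj, hj0⟩ := Submodule.exists_mem_ne_zero_of_ne_bot hJ0
  obtain ⟨r, hr⟩ := exists_mul_mul_ne_zero_of_prime hprime hj0 hi0
  exact hr (Submodule.disjoint_def.mp hJ.disjoint _ (I.mul_mem_left _ hi)
    (J.smul_mem (op i) (J.smul_mem (op r) hj)))

/-- A right finite-dimensional prime ring with a non-singular simple right module is
simple artinian. -/
theorem stmt10 {A : Type u} [Ring A]
    (hprime : ∀ B C : TwoSidedIdeal A, B ≠ ⊥ → C ≠ ⊥ → ∃ b ∈ B, ∃ c ∈ C, b * c ≠ 0)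
    (hfd : ∀ (ι : Type u) (f : ι → Submodule Aᵐᵒᵖ A),
      iSupIndep f → (∀ i, f i ≠ ⊥) → Finite ι)
    (S : Type v) [AddCommGroup S] [Module Aᵐᵒᵖ S] [IsSimpleModule Aᵐᵒᵖ S]
    (hS : singularSet A S ≠ Set.univ) :
    IsSimpleRing A ∧ IsArtinian Aᵐᵒᵖ A := by
  obtain ⟨Y, hY⟩ := exists_isSimpleModule_submodule_of_singularSet_ne_univ S hS
  obtain ⟨F, hF⟩ := exists_finset_iInf_ker_mulLeft_eq_bot hprime hfd Y
  have : Nontrivial Y := IsSimpleModule.nontrivial Aᵐᵒᵖ Y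
  have : Nontrivial A := Y.subtype_injective.nontrivial
  have : IsArtinian Aᵐᵒᵖ Y := IsSimpleModule.isArtinian Aᵐᵒᵖ Y
  have : IsArtinian Aᵐᵒᵖ (F → Y) := isArtinian_pi'
  let φ : A →ₗ[Aᵐᵒᵖ] (F → Y) := LinearMap.pi fun y =>
    (LinearMap.mulLeft Aᵐᵒᵖ (y : A)).codRestrict Y fun a => Y.smul_mem (op a) y.1.2
  have hφ : Function.Injective φ := by
    rw [injective_iff_map_eq_zero]
    intro a ha
    rw [← Submodule.mem_bot Aᵐᵒᵖ, ← hF]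
    simp only [Submodule.mem_iInf]
    exact fun y hy => congrArg Subtype.val (congrFun ha ⟨y, hy⟩)
  have : IsSemisimpleModule Aᵐᵒᵖ A := IsSemisimpleModule.of_injective φ hφ
  exact ⟨isSimpleRing_of_prime_of_isSemisimpleModule hprime, isArtinian_of_injective φ hφ⟩
end

section
/- Let A be a ring such that every simple right A-module is singular (i.e., Sing S = S for every simple right A-module S). Then every generalized bassian non-singular right A-module M (i.e., with Sing M = 0) is a bassian right A-module. -/
open MulOpposite DirectSum

theorem rightAnnihilator_map {A : Type*} [Ring A] {M N : Type*} [AddCommGroup M] [Module Aᵐᵒᵖ M]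
    [AddCommGroup N] [Module Aᵐᵒᵖ N] (f : M →ₗ[Aᵐᵒᵖ] N) (hf : Function.Injective f) (m : M) :
    rightAnnihilator A (f m) = rightAnnihilator A m := by
  ext a
  change op a • f m = 0 ↔ op a • m = 0
  rw [← map_smul, map_eq_zero_iff f hf]

/-- If `M` is generalized bassian and embeds in `M ⧸ N`, then `N` is semisimple. -/
theorem IsGeneralizedBassian.isSemisimpleModule {R M : Type*} [Ring R] [AddCommGroup M]
    [Module R M] (hM : IsGeneralizedBassian R M) (N : Submodule R M)
    (h : ∃ f : M →ₗ[R] M ⧸ N, Function.Injective f) : IsSemisimpleModule R N := by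
  obtain ⟨N', hN'⟩ := hM N h
  obtain ⟨f, hf⟩ := h
  refine (isSemisimpleModule_iff R N).mpr ⟨fun X => ?_⟩
  have hX : X.map N.subtype ≤ N := Submodule.map_subtype_le N X
  have hinj : Function.Injective ((X.map N.subtype).mkQ ∘ₗ N'.subtype) := by
    rw [← LinearMap.ker_eq_bot, LinearMap.ker_comp, Submodule.ker_mkQ,
      ← Submodule.disjoint_iff_comap_eq_bot]
    exact (hN'.disjoint.mono_left hX).symm
  obtain ⟨Y, hY⟩ := hM (X.map N.subtype)
    ⟨((X.map N.subtype).mkQ ∘ₗ N'.subtype) ∘ₗ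
      (Submodule.quotientEquivOfIsCompl N N' hN').toLinearMap ∘ₗ f,
      hinj.comp ((N.quotientEquivOfIsCompl N' hN').injective.comp hf)⟩
  refine ⟨Y.comap N.subtype, disjoint_iff.mpr ?_, codisjoint_iff.mpr ?_⟩
  · apply Submodule.map_injective_of_injective N.injective_subtype
    rw [Submodule.map_inf _ N.injective_subtype, Submodule.map_comap_subtype, Submodule.map_bot,
      eq_bot_iff, ← hY.inf_eq_bot]
    exact inf_le_inf_left _ inf_le_right
  · apply Submodule.map_injective_of_injective N.injective_subtype
    rw [Submodule.map_sup, Submodule.map_comap_subtype, Submodule.map_subtype_top, inf_comm N Y,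
      ← sup_inf_assoc_of_le Y hX, hY.sup_eq_top, top_inf_eq]

/-- If every simple right `A`-module is singular, then every generalized bassian
non-singular right `A`-module is bassian. -/
theorem stmt11 {A : Type u} [Ring A]
    (hsing : ∀ (S : Type u) [AddCommGroup S] [Module Aᵐᵒᵖ S],
      IsSimpleModule Aᵐᵒᵖ S → singularSet A S = Set.univ)
    (M : Type v) [AddCommGroup M] [Module Aᵐᵒᵖ M]
    (hM : IsGeneralizedBassian Aᵐᵒᵖ M) (hns : singularSet A M = {0}) :
    IsBassian Aᵐᵒᵖ M := by
  intro N hN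
  by_contra hne
  have hss := hM.isSemisimpleModule N hN
  have : Nontrivial N := Submodule.nontrivial_iff_ne_bot.mpr hne
  obtain ⟨S, hS⟩ := IsSemisimpleModule.exists_simple_submodule Aᵐᵒᵖ N
  obtain ⟨I, hI, ⟨e⟩⟩ := isSimpleModule_iff_quot_maximal.mp hS
  have hsimple : IsSimpleModule Aᵐᵒᵖ (Aᵐᵒᵖ ⧸ I) :=
    isSimpleModule_iff_quot_maximal.mpr ⟨I, hI, ⟨LinearEquiv.refl _ _⟩⟩
  have := hsimple.nontrivial
  obtain ⟨x, hx⟩ := exists_ne (0 : Aᵐᵒᵖ ⧸ I)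
  let g : (Aᵐᵒᵖ ⧸ I) →ₗ[Aᵐᵒᵖ] M := N.subtype ∘ₗ S.subtype ∘ₗ e.symm.toLinearMap
  have hg : Function.Injective g :=
    N.injective_subtype.comp (S.injective_subtype.comp e.symm.injective)
  have hxs : x ∈ singularSet A (Aᵐᵒᵖ ⧸ I) := hsing _ hsimple ▸ Set.mem_univ x
  have hgx : g x ∈ singularSet A M := by
    change IsEssentialSubmodule (rightAnnihilator A (g x))
    rw [rightAnnihilator_map g hg]
    exact hxs
  rw [hns, Set.mem_singleton_iff, map_eq_zero_iff g hg] at hgx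
  exact hx hgx
end

section
/- Let A be a ring, let M be a bassian right A-module which is directly bounded, and let S be a semisimple right A-module. Then the right A-module M ⊕ S is generalized bassian. -/
open MulOpposite DirectSum

section Bassian

variable {R : Type*} [Ring R] {M : Type*} [AddCommGroup M] [Module R M]

/-- If two submodules span and the second one is semisimple, then the first one has a complement
inside the second one. -/
theorem exists_isCompl_le_of_sup_eq_top {P Q : Submodule R M} [IsSemisimpleModule R Q]
    (h : P ⊔ Q = ⊤) : ∃ C ≤ Q, IsCompl P C := by
  obtain ⟨D, hD⟩ := exists_isCompl (P.comap Q.subtype)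
  refine ⟨D.map Q.subtype, Submodule.map_subtype_le Q D, ?_, ?_⟩
  · rw [Submodule.disjoint_def]
    rintro _ hx ⟨d, hd, rfl⟩
    rw [Submodule.disjoint_def.1 hD.disjoint d hx hd, map_zero]
  · rw [codisjoint_iff, eq_top_iff, ← h, sup_le_iff]
    refine ⟨le_sup_left, fun x hx ↦ ?_⟩
    obtain ⟨a, ha, d, hd, had⟩ := Submodule.mem_sup.1
      (show (⟨x, hx⟩ : Q) ∈ P.comap Q.subtype ⊔ D from hD.sup_eq_top ▸ Submodule.mem_top)
    exact Submodule.mem_sup.2 ⟨a, ha, d, ⟨d, hd, rfl⟩, congr_arg Subtype.val had⟩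

/-- A submodule of `P ⊕ Q` with `Q` semisimple is a direct summand as soon as its intersection
with `P` is a direct summand of `P`. -/
theorem exists_isCompl_of_exists_isCompl_comap {P Q : Submodule R M} [IsSemisimpleModule R Q]
    (h : P ⊔ Q = ⊤) (N : Submodule R M)
    (hN : ∃ C, IsCompl (N.comap P.subtype) C) : ∃ N', IsCompl N N' := by
  obtain ⟨C, hC⟩ := hN
  have hP : P ≤ N ⊔ C.map P.subtype := fun x hx ↦ by
    obtain ⟨a, ha, c, hc, hac⟩ := Submodule.mem_sup.1
      (show (⟨x, hx⟩ : P) ∈ N.comap P.subtype ⊔ C from hC.sup_eq_top ▸ Submodule.mem_top)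
    exact Submodule.mem_sup.2 ⟨a, ha, c, ⟨c, hc, rfl⟩, congr_arg Subtype.val hac⟩
  have htop : (N ⊔ C.map P.subtype) ⊔ Q = ⊤ := eq_top_iff.2 (h ▸ sup_le_sup_right hP Q)
  obtain ⟨D, -, hD⟩ := exists_isCompl_le_of_sup_eq_top htop
  have hNC : Disjoint N (C.map P.subtype) := by
    rw [Submodule.disjoint_def]
    rintro _ hx ⟨c, hc, rfl⟩
    rw [Submodule.disjoint_def.1 hC.disjoint c hx hc, map_zero]
  exact ⟨C.map P.subtype ⊔ D, hNC.disjoint_sup_right_of_disjoint_sup_left hD.disjoint,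
    codisjoint_iff.2 (by rw [← sup_assoc, hD.sup_eq_top])⟩

/-- A module which embeds into `P ⊕ C` with `C` semisimple splits as a direct sum of a module
which embeds into `C` and a module which embeds into `P`. -/
theorem exists_isCompl_of_injective_of_isCompl {L : Type*} [AddCommGroup L] [Module R L]
    {P C : Submodule R M} [IsSemisimpleModule R C] (h : IsCompl P C)
    (f : L →ₗ[R] M) (hf : Function.Injective f) :
    ∃ U V : Submodule R L, IsCompl U V ∧ (∃ g : U →ₗ[R] C, Function.Injective g) ∧
      ∃ g : V →ₗ[R] P, Function.Injective g := by
  let p := P.projectionOnto C h ∘ₗ f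
  let q := C.projectionOnto P h.symm ∘ₗ f
  let U := LinearMap.ker p
  have hq : Function.Injective (q ∘ₗ U.subtype) := by
    rw [injective_iff_map_eq_zero]
    rintro ⟨x, hx⟩ hx'
    have h1 : f x ∈ C := by simpa [U, p, -Submodule.coe_projectionOnto_apply] using hx
    have h2 : f x ∈ P := by simpa [q, -Submodule.coe_projectionOnto_apply] using hx'
    exact Subtype.ext (hf (by simpa using Submodule.disjoint_def.1 h.disjoint _ h2 h1))
  obtain ⟨r, hr⟩ := IsSemisimpleModule.extension_property _ hq LinearMap.id
  have hUV : IsCompl U (LinearMap.ker (r ∘ₗ q)) :=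
    LinearMap.isCompl_of_proj fun x ↦ LinearMap.congr_fun hr x
  refine ⟨U, _, hUV, ⟨_, hq⟩, p ∘ₗ Submodule.subtype _, ?_⟩
  rw [injective_iff_map_eq_zero]
  rintro ⟨x, hx⟩ hx'
  exact Subtype.ext (Submodule.disjoint_def.1 hUV.disjoint x hx' hx)

theorem IsBassian.of_isCompl (hM : IsBassian R M) {P Q : Submodule R M} (h : IsCompl P Q) :
    IsBassian R P := by
  rintro N ⟨f, hf⟩
  let N₀ := N.map P.subtype
  let e : P ⧸ N →ₗ[R] M ⧸ N₀ := N.mapQ N₀ P.subtype (Submodule.le_comap_map _ _)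
  let F : M →ₗ[R] M ⧸ N₀ :=
    e ∘ₗ f ∘ₗ P.projectionOnto Q h + N₀.mkQ ∘ₗ Q.subtype ∘ₗ Q.projectionOnto P h.symm
  have hF : Function.Injective F := by
    rw [injective_iff_map_eq_zero]
    intro x hx
    obtain ⟨y, hy⟩ := N.mkQ_surjective (f (P.projectionOnto Q h x))
    have hx' : N₀.mkQ (y + Q.projectionOnto P h.symm x : M) = 0 := by
      rw [map_add, ← hx]
      simp only [F, LinearMap.add_apply, LinearMap.comp_apply, ← hy]
      rfl
    obtain ⟨z, hz, hzy⟩ := (Submodule.Quotient.mk_eq_zero _).1 hx'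
    have hQ : (Q.projectionOnto P h.symm x : M) = 0 := by
      refine Submodule.disjoint_def.1 h.disjoint _ ?_ (Submodule.coe_mem _)
      rw [← sub_eq_of_eq_add' hzy]
      exact P.sub_mem z.2 y.2
    have hyN : y ∈ N := by
      rw [hQ, add_zero] at hzy
      rwa [← Subtype.ext hzy]
    have hy0 : N.mkQ y = 0 := (Submodule.Quotient.mk_eq_zero _).2 hyN
    rw [hy0] at hy
    have hP := (injective_iff_map_eq_zero f).1 hf _ hy.symm
    rw [← Submodule.projection_add_projection_eq_self h x, Submodule.projection_apply,
      Submodule.projection_apply, hP, hQ]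
    simp
  exact Submodule.map_injective_of_injective P.subtype_injective
    ((hM N₀ ⟨F, hF⟩).trans (Submodule.map_bot _).symm)

theorem IsBassian.of_linearEquiv {M' : Type*} [AddCommGroup M'] [Module R M']
    (hM : IsBassian R M) (e : M ≃ₗ[R] M') : IsBassian R M' := by
  rintro N ⟨f, hf⟩
  let N₀ := N.comap e.toLinearMap
  have hN : N₀.map e.toLinearMap = N := Submodule.map_comap_eq_of_surjective e.surjective N
  have := hM N₀ ⟨(Submodule.Quotient.equiv N₀ N e hN).symm.toLinearMap ∘ₗ f ∘ₗ e.toLinearMap,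
    (Submodule.Quotient.equiv N₀ N e hN).symm.injective.comp (hf.comp e.injective)⟩
  rw [← hN, this, Submodule.map_bot]

end Bassian

section SplitPower

universe u

/-- No simple module embedding into `S` has its `n`-th power as a direct summand of `M`. -/
def NoSplitPower (R : Type*) [Ring R] (M S : Type u) [AddCommGroup M] [Module R M]
    [AddCommGroup S] [Module R S] (n : ℕ) : Prop :=
  ∀ (T : Type u) [AddCommGroup T] [Module R T], IsSimpleModule R T →
    ∀ j : T →ₗ[R] S, Function.Injective j →
      ∀ (i : (Fin n → T) →ₗ[R] M) (r : M →ₗ[R] (Fin n → T)), r ∘ₗ i ≠ LinearMap.id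

variable {R : Type*} [Ring R]

theorem NoSplitPower.subsingleton {M S : Type u} [AddCommGroup M] [Module R M]
    [AddCommGroup S] [Module R S] [IsSemisimpleModule R S] (h : NoSplitPower R M S 0) :
    Subsingleton S := by
  by_contra hS
  rw [not_subsingleton_iff_nontrivial] at hS
  obtain ⟨T, hT⟩ := IsSemisimpleModule.exists_simple_submodule R S
  exact h T hT T.subtype T.subtype_injective 0 0 (LinearMap.ext fun x ↦ Subsingleton.elim _ _)

theorem NoSplitPower.of_isCompl {M S : Type u} [AddCommGroup M] [Module R M]
    [AddCommGroup S] [Module R S] {n : ℕ} (h : NoSplitPower R M S (n + 1))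
    {U V : Submodule R M} (hUV : IsCompl U V) [IsSemisimpleModule R U]
    (g : U →ₗ[R] S) (hg : Function.Injective g) : NoSplitPower R V U n := by
  intro T _ _ hT j hj i r hri
  obtain ⟨s, hs⟩ := IsSemisimpleModule.extension_property j hj LinearMap.id
  let e := Fin.consLinearEquiv R fun _ : Fin (n + 1) ↦ T
  let p := U.projectionOnto V hUV
  let q := V.projectionOnto U hUV.symm
  refine h T hT (g ∘ₗ j) (hg.comp hj)
    ((U.subtype ∘ₗ j).coprod (V.subtype ∘ₗ i) ∘ₗ e.symm.toLinearMap)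
    (e.toLinearMap ∘ₗ (s ∘ₗ p).prod (r ∘ₗ q)) (LinearMap.ext fun x ↦ ?_)
  obtain ⟨⟨a, b⟩, rfl⟩ := e.surjective x
  have h1 : s (j a) = a := LinearMap.congr_fun hs a
  have h2 : r (i b) = b := LinearMap.congr_fun hri b
  simp [p, q, h1, h2]

/-- If `P` is bassian, `Q` is semisimple and the multiplicities in `P` of the simple submodules of
`Q` are bounded, then every `N` such that `P` embeds into `(P ⊕ Q) ⧸ N` is a direct summand. -/
theorem exists_isCompl_of_noSplitPower (n : ℕ) :
    ∀ {M : Type u} [AddCommGroup M] [Module R M] {P Q : Submodule R M},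
      IsCompl P Q → IsSemisimpleModule R Q → IsBassian R P → NoSplitPower R P Q n →
      ∀ (N : Submodule R M) (f : P →ₗ[R] M ⧸ N), Function.Injective f →
        ∃ N', IsCompl N N' := by
  induction n with
  | zero =>
    intro M _ _ P Q hPQ _ hP hn N f hf
    have := hn.subsingleton
    refine exists_isCompl_of_exists_isCompl_comap hPQ.sup_eq_top N ?_
    have hker : LinearMap.ker (N.mkQ ∘ₗ P.subtype) = N.comap P.subtype := by
      rw [LinearMap.ker_comp, Submodule.ker_mkQ]
    have hPtop : P = ⊤ := by
      rw [← hPQ.sup_eq_top, (Submodule.subsingleton_iff_eq_bot).1 this, sup_bot_eq]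
    have hsurj : Function.Surjective (N.mkQ ∘ₗ P.subtype) := by
      rw [← LinearMap.range_eq_top, LinearMap.range_comp, Submodule.range_subtype, hPtop,
        Submodule.map_top, Submodule.range_mkQ]
    let e := (N.mkQ ∘ₗ P.subtype).quotKerEquivOfSurjective hsurj
    have := hP _ ⟨e.symm.toLinearMap ∘ₗ f, e.symm.injective.comp hf⟩
    rw [← hker, this]
    exact ⟨⊤, isCompl_bot_top⟩
  | succ n ih =>
    intro M _ _ P Q hPQ _ hP hn N f hf
    refine exists_isCompl_of_exists_isCompl_comap hPQ.sup_eq_top N ?_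
    have hker : LinearMap.ker (N.mkQ ∘ₗ P.subtype) = N.comap P.subtype := by
      rw [LinearMap.ker_comp, Submodule.ker_mkQ]
    let φ := N.mkQ ∘ₗ P.subtype
    let ψ := N.mkQ ∘ₗ Q.subtype
    have htop : LinearMap.range φ ⊔ LinearMap.range ψ = ⊤ := by
      rw [LinearMap.range_comp, LinearMap.range_comp, Submodule.range_subtype,
        Submodule.range_subtype, ← Submodule.map_sup, hPQ.sup_eq_top, Submodule.map_top,
        Submodule.range_mkQ]
    have : IsSemisimpleModule R (LinearMap.range ψ) := .range ψ
    obtain ⟨C, hCψ, hC⟩ := exists_isCompl_le_of_sup_eq_top htop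
    have : IsSemisimpleModule R C :=
      .of_injective (Submodule.inclusion hCψ) (Submodule.inclusion_injective hCψ)
    obtain ⟨U, V, hUV, ⟨g, hg⟩, ⟨k, hk⟩⟩ := exists_isCompl_of_injective_of_isCompl hC f hf
    have hU : IsSemisimpleModule R U := .of_injective g hg
    obtain ⟨l, hl⟩ := IsSemisimpleModule.lifting_property ψ.rangeRestrict
      ψ.surjective_rangeRestrict (Submodule.inclusion hCψ)
    have hlinj : Function.Injective l := by
      refine Function.Injective.of_comp (f := ψ.rangeRestrict) ?_
      rw [← LinearMap.coe_comp, hl]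
      exact Submodule.inclusion_injective hCψ
    rw [← hker]
    exact ih hUV.symm hU (hP.of_isCompl hUV.symm) (hn.of_isCompl hUV (l ∘ₗ g) (hlinj.comp hg)) _
      (φ.quotKerEquivRange.symm.toLinearMap ∘ₗ k) (φ.quotKerEquivRange.symm.injective.comp hk)

end SplitPower

/-- If `M` is a directly bounded bassian module and `S` is semisimple, then `M ⊕ S`
is generalized bassian. -/
theorem stmt13 {A M S : Type*} [Ring A] [AddCommGroup M] [Module Aᵐᵒᵖ M]
    [AddCommGroup S] [Module Aᵐᵒᵖ S]
    (hM : IsBassian Aᵐᵒᵖ M)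
    (hdb : ∃ n : ℕ, 0 < n ∧ ∀ T : Submodule Aᵐᵒᵖ M, IsSimpleModule Aᵐᵒᵖ ↥T →
      ∀ D : Submodule Aᵐᵒᵖ M, (∃ D' : Submodule Aᵐᵒᵖ M, IsCompl D D') →
        IsEmpty (↥D ≃ₗ[Aᵐᵒᵖ] (Fin n → ↥T)))
    (hS : IsSemisimpleModule Aᵐᵒᵖ S) :
    IsGeneralizedBassian Aᵐᵒᵖ (M × S) := by
  rintro N ⟨f, hf⟩
  obtain ⟨n, hn, hdb⟩ := hdb
  let P := LinearMap.range (LinearMap.inl Aᵐᵒᵖ M S)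
  let Q := LinearMap.range (LinearMap.inr Aᵐᵒᵖ M S)
  have hPQ : IsCompl P Q := LinearMap.isCompl_range_inl_inr
  let e : M ≃ₗ[Aᵐᵒᵖ] P := LinearEquiv.ofInjective _ LinearMap.inl_injective
  have hP : IsBassian Aᵐᵒᵖ P := hM.of_linearEquiv e
  refine exists_isCompl_of_noSplitPower n hPQ (.range _) hP ?_ N (f ∘ₗ P.subtype)
    (hf.comp P.subtype_injective)
  intro T _ _ hT j hj i r hri
  let i' := e.symm.toLinearMap ∘ₗ i
  let r' := r ∘ₗ e.toLinearMap
  have hri' : Function.LeftInverse r' i' := fun x ↦ by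
    simpa [r', i'] using LinearMap.congr_fun hri x
  let t := i' ∘ₗ LinearMap.single Aᵐᵒᵖ (fun _ : Fin n ↦ T) ⟨0, hn⟩
  have ht : Function.Injective t := hri'.injective.comp
    (Pi.single_injective (M := fun _ : Fin n ↦ T) _)
  let eT := LinearEquiv.ofInjective t ht
  let eD := LinearEquiv.ofInjective i' hri'.injective
  refine (hdb (LinearMap.range t) (.congr eT.symm) (LinearMap.range i')
    ⟨LinearMap.ker (eD.toLinearMap ∘ₗ r'), LinearMap.isCompl_of_proj ?_⟩).false
    (eD.symm ≪≫ₗ LinearEquiv.piCongrRight fun _ ↦ eT)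
  rintro ⟨_, x, rfl⟩
  exact Subtype.ext (congr_arg i' (hri' x))
end

section
/- Let A be a ring, let K be a nonzero right A-module, let T be an infinite index set, and let H = ⊕_{t∈T} K_t be a direct sum of copies K_t ≅ K of K. If H is a generalized bassian right A-module, then K is a semisimple module. -/
open MulOpposite DirectSum

/-- Reindexing a direct sum of copies of `K` along an injection `e` is inverted
coordinatewise by evaluation at `e t`. -/
theorem toModule_lof_apply_of_injective {R K T : Type*} [Ring R] [AddCommGroup K] [Module R K]
    [DecidableEq T] {e : T → T} (he : Function.Injective e) (x : ⨁ _ : T, K) (t : T) :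
    (DirectSum.toModule R T (⨁ _ : T, K) fun s => DirectSum.lof R T (fun _ => K) (e s)) x (e t)
      = x t := by
  induction x using DirectSum.induction_on with
  | zero => simp
  | of i k =>
    rw [← DirectSum.lof_eq_of R, DirectSum.toModule_lof]
    by_cases h : i = t
    · subst h
      rw [DirectSum.lof_apply, DirectSum.lof_apply]
    · rw [DirectSum.lof_eq_of, DirectSum.lof_eq_of, DirectSum.of_eq_of_ne _ _ _ (Ne.symm h),
        DirectSum.of_eq_of_ne _ _ _ (he.ne (Ne.symm h))]
  | add x y hx hy => rw [map_add, DirectSum.add_apply, DirectSum.add_apply, hx, hy]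

/-- If the image of `L` under an injective linear map is a direct summand, so is `L`. -/
theorem Submodule.isCompl_comap_of_isCompl_map {R K H : Type*} [Ring R] [AddCommGroup K]
    [Module R K] [AddCommGroup H] [Module R H] {i : K →ₗ[R] H} (hi : Function.Injective i)
    {L : Submodule R K} {N' : Submodule R H} (h : IsCompl (L.map i) N') :
    IsCompl L (N'.comap i) := by
  refine ⟨Submodule.disjoint_def.2 fun x hx hx' => ?_,
    codisjoint_iff.2 (eq_top_iff.2 fun k _ => ?_)⟩
  · apply hi
    rw [map_zero]
    exact Submodule.disjoint_def.1 h.disjoint _ (Submodule.mem_map_of_mem hx) hx'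
  · have hk : i k ∈ L.map i ⊔ N' := by rw [h.sup_eq_top]; trivial
    obtain ⟨_, ⟨l, hl, rfl⟩, n, hn, hln⟩ := Submodule.mem_sup.1 hk
    refine Submodule.mem_sup.2 ⟨l, hl, k - l, ?_, add_sub_cancel l k⟩
    rwa [Submodule.mem_comap, map_sub, ← hln, add_sub_cancel_left]

/-- If a direct sum of infinitely many copies of a nonzero module `K` is generalized
bassian, then `K` is semisimple. -/
theorem stmt15 {A K : Type*} [Ring A] [AddCommGroup K] [Module Aᵐᵒᵖ K] [Nontrivial K]
    (T : Type*) [Infinite T]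
    (hH : IsGeneralizedBassian Aᵐᵒᵖ (⨁ _ : T, K)) :
    IsSemisimpleModule Aᵐᵒᵖ K := by
  classical
  obtain ⟨e, he, t₀, ht₀⟩ : ∃ e : T → T, Function.Injective e ∧ ∃ t₀, ∀ t, e t ≠ t₀ := by
    obtain ⟨φ⟩ := Cardinal.eq.1 <| (Cardinal.mk_option (α := T)).trans
      (Cardinal.add_one_eq (Cardinal.aleph0_le_mk T))
    exact ⟨φ ∘ some, φ.injective.comp (Option.some_injective T), φ none,
      fun t h => Option.some_ne_none t (φ.injective h)⟩
  rw [isSemisimpleModule_iff]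
  refine ⟨fun L => ?_⟩
  obtain ⟨N', hN'⟩ := hH (L.map (DirectSum.lof Aᵐᵒᵖ T (fun _ => K) t₀))
    ⟨(Submodule.mkQ _).comp (DirectSum.toModule Aᵐᵒᵖ T (⨁ _ : T, K)
      fun s => DirectSum.lof Aᵐᵒᵖ T (fun _ => K) (e s)), by
      refine (injective_iff_map_eq_zero _).2 fun x hx => ?_
      rw [LinearMap.comp_apply, Submodule.mkQ_apply, Submodule.Quotient.mk_eq_zero] at hx
      obtain ⟨l, -, hl⟩ := hx
      refine DFinsupp.ext fun t => ?_
      have := toModule_lof_apply_of_injective (R := Aᵐᵒᵖ) he x t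
      rw [← hl, DirectSum.lof_eq_of, DirectSum.of_eq_of_ne _ _ _ (ht₀ t)] at this
      exact this.symm⟩
  exact ⟨_, Submodule.isCompl_comap_of_isCompl_map
    (DFinsupp.single_injective (i := t₀) (β := fun _ : T => K)) hN'⟩
end

section
/- Let A be a ring, let N be a noetherian right A-module, and let S be a semisimple right A-module. Then the right A-module N ⊕ S is generalized bassian. -/
open MulOpposite DirectSum

section

variable {R M : Type*} [Ring R] [AddCommGroup M] [Module R M]

/-- A submodule on which some linear map to a semisimple module is injective is a direct summand. -/
lemma Submodule.exists_isCompl_of_disjoint_ker {W : Type*} [AddCommGroup W] [Module R W]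
    [IsSemisimpleModule R W] (K : Submodule R M) (φ : M →ₗ[R] W)
    (hφ : Disjoint K (LinearMap.ker φ)) : ∃ K' : Submodule R M, IsCompl K K' := by
  obtain ⟨C, hC⟩ := ComplementedLattice.exists_isCompl (K.map φ)
  refine ⟨C.comap φ, ?_, ?_⟩
  · rw [Submodule.disjoint_def] at hφ ⊢
    intro x hx hxC
    exact hφ x hx (Submodule.disjoint_def.1 hC.disjoint _ (Submodule.mem_map_of_mem hx) hxC)
  · rw [codisjoint_iff, eq_top_iff]
    intro x _
    have hx : φ x ∈ K.map φ ⊔ C := hC.sup_eq_top ▸ Submodule.mem_top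
    obtain ⟨_, ⟨k, hk, rfl⟩, c, hc, hkc⟩ := Submodule.mem_sup.1 hx
    refine Submodule.mem_sup.2 ⟨k, hk, x - k, ?_, add_sub_cancel k x⟩
    rwa [Submodule.mem_comap, map_sub, ← hkc, add_sub_cancel_left]

/-- If `M` embeds in `M ⧸ K` via `f` and in `M ⧸ X` via `g`, then it embeds in the quotient of `M`
by the preimage of `g(K)`. -/
lemma Submodule.exists_injective_quotient_comap_map {K X : Submodule R M}
    {f : M →ₗ[R] M ⧸ K} (hf : Function.Injective f)
    {g : M →ₗ[R] M ⧸ X} (hg : Function.Injective g) :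
    ∃ g' : M →ₗ[R] M ⧸ (K.map g).comap X.mkQ, Function.Injective g' := by
  have hX : X ≤ (K.map g).comap X.mkQ := X.le_comap_mkQ _
  have hker : LinearMap.ker (Submodule.factor hX ∘ₗ g) = K := by
    ext x
    obtain ⟨y, hy⟩ := X.mkQ_surjective (g x)
    rw [LinearMap.mem_ker, LinearMap.comp_apply, ← hy, Submodule.factor_mk, Submodule.mkQ_apply,
      Submodule.Quotient.mk_eq_zero, Submodule.mem_comap, hy]
    exact hg.mem_set_image
  refine ⟨K.liftQ _ hker.ge ∘ₗ f, ?_⟩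
  rw [LinearMap.coe_comp]
  exact (LinearMap.ker_eq_bot.1 (Submodule.ker_liftQ_eq_bot _ _ _ hker.le)).comp hf

/-- An extension of a semisimple module by a noetherian module is generalized bassian. -/
lemma isGeneralizedBassian_of_isNoetherian_of_isSemisimpleModule_quotient (N : Submodule R M)
    [IsNoetherian R N] [IsSemisimpleModule R (M ⧸ N)] : IsGeneralizedBassian R M := by
  rintro K ⟨f, hf⟩
  obtain ⟨_, ⟨X, ⟨g, hg⟩, rfl⟩, hmax⟩ := WellFounded.has_min
    (wellFounded_gt (α := Submodule R N))
    ((fun X : Submodule R M ↦ X.comap N.subtype) ''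
      {X | ∃ g : M →ₗ[R] M ⧸ X, Function.Injective g})
    ⟨_, K, ⟨f, hf⟩, rfl⟩
  set X' := (K.map g).comap X.mkQ with hX'
  have hX : X ≤ X' := X.le_comap_mkQ _
  have hXN : ∀ n ∈ N, n ∈ X' → n ∈ X := by
    have h := eq_of_le_of_not_lt (Submodule.comap_mono (f := N.subtype) hX)
      (hmax _ ⟨X', Submodule.exists_injective_quotient_comap_map hf hg, rfl⟩)
    intro n hn hnX
    exact h.ge (show (⟨n, hn⟩ : N) ∈ X'.comap N.subtype from hnX)
  have : IsSemisimpleModule R (M ⧸ X ⊔ N) :=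
    .of_surjective (Submodule.factor (le_sup_right : N ≤ X ⊔ N))
      (Submodule.factor_surjective _)
  refine K.exists_isCompl_of_disjoint_ker
    (Submodule.factor (le_sup_left : X ≤ X ⊔ N) ∘ₗ g) ?_
  rw [Submodule.disjoint_def]
  intro k hk hk0
  obtain ⟨y, hy⟩ := X.mkQ_surjective (g k)
  have hyX' : y ∈ X' := by
    rw [hX', Submodule.mem_comap, hy]
    exact Submodule.mem_map_of_mem hk
  rw [LinearMap.mem_ker, LinearMap.comp_apply, ← hy, Submodule.factor_mk, Submodule.mkQ_apply,
      Submodule.Quotient.mk_eq_zero] at hk0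
  obtain ⟨a, ha, n, hn, rfl⟩ := Submodule.mem_sup.1 hk0
  have hnX : n ∈ X := hXN n hn ((Submodule.add_mem_iff_right _ (hX ha)).1 hyX')
  apply hg
  rw [← hy, map_zero, Submodule.mkQ_apply,
      Submodule.Quotient.mk_eq_zero]
  exact X.add_mem ha hnX

end

/-- The direct sum of a noetherian module and a semisimple module is generalized
bassian. -/
theorem stmt16 {A N S : Type*} [Ring A] [AddCommGroup N] [Module Aᵐᵒᵖ N]
    [AddCommGroup S] [Module Aᵐᵒᵖ S]
    (hN : IsNoetherian Aᵐᵒᵖ N) (hS : IsSemisimpleModule Aᵐᵒᵖ S) :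
    IsGeneralizedBassian Aᵐᵒᵖ (N × S) := by
  have : IsSemisimpleModule Aᵐᵒᵖ ((N × S) ⧸ LinearMap.ker (LinearMap.snd Aᵐᵒᵖ N S)) :=
    .congr ((LinearMap.snd Aᵐᵒᵖ N S).quotKerEquivOfSurjective LinearMap.snd_surjective)
  have : IsNoetherian Aᵐᵒᵖ (LinearMap.ker (LinearMap.snd Aᵐᵒᵖ N S)) := by
    rw [LinearMap.ker_snd]
    infer_instance
  exact isGeneralizedBassian_of_isNoetherian_of_isSemisimpleModule_quotient
    (LinearMap.ker (LinearMap.snd Aᵐᵒᵖ N S))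
end

section
/- Let A be a ring and let M be a noetherian right A-module. Then M is a bassian right A-module. -/
open MulOpposite DirectSum

/-- A noetherian module over any ring is bassian: an embedding `f : M → M ⧸ N` exhibits `M` as a
quotient by `N` of the submodule `N.mkQ ⁻¹ (range f)` of `M`, so `N` vanishes because noetherian
modules have the Orzech property. -/
theorem IsBassian.of_isNoetherian {R M : Type*} [Ring R] [AddCommGroup M] [Module R M]
    [IsNoetherian R M] : IsBassian R M := by
  rintro N ⟨f, hf⟩
  let K : Submodule R M := (LinearMap.range f).comap N.mkQ
  let q : K →ₗ[R] LinearMap.range f := N.mkQ.restrict fun _ hx => hx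
  let g : K →ₗ[R] M := (LinearEquiv.ofInjective f hf).symm.toLinearMap ∘ₗ q
  have hq : Function.Surjective q := by
    rintro ⟨y, hy⟩
    obtain ⟨x, rfl⟩ := N.mkQ_surjective y
    exact ⟨⟨x, hy⟩, rfl⟩
  have hg : Function.Surjective g := (LinearEquiv.ofInjective f hf).symm.surjective.comp hq
  have hg_inj : Function.Injective g :=
    IsNoetherian.injective_of_surjective_of_submodule g hg
  have hq_inj : Function.Injective q :=
    Function.Injective.of_comp (f := (LinearEquiv.ofInjective f hf).symm) hg_inj
  refine (Submodule.eq_bot_iff N).2 fun x hx => ?_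
  have hx0 : N.mkQ x = 0 := (Submodule.Quotient.mk_eq_zero N).2 hx
  have hxK : x ∈ K := by simp only [K, Submodule.mem_comap, hx0, zero_mem]
  have h : (⟨x, hxK⟩ : K) = 0 := hq_inj (Subtype.ext (hx0.trans (by simp)))
  exact congrArg Subtype.val h

/-- Every noetherian module is bassian. -/
theorem stmt17 {A M : Type*} [Ring A] [AddCommGroup M] [Module Aᵐᵒᵖ M]
    (hM : IsNoetherian Aᵐᵒᵖ M) :
    IsBassian Aᵐᵒᵖ M := by
  exact .of_isNoetherian
end

section
/- Let A be a ring and let M be a right A-module. If the polynomial module M[X] (the module of polynomials with coefficients in M, viewed as a right module over the polynomial ring A[X]) is a bassian A[X]-module, then M is a bassian right A-module. -/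
open MulOpposite DirectSum

open Polynomial in
/-- Induction on the opposite of a polynomial ring: it is generated by constants and `X`. -/
theorem op_polynomial_induction {A : Type*} [Ring A] {motive : (Polynomial A)ᵐᵒᵖ → Prop}
    (hC : ∀ a, motive (op (C a))) (hX : motive (op X))
    (hadd : ∀ r s, motive r → motive s → motive (r + s))
    (hmul : ∀ r s, motive r → motive s → motive (r * s)) (r : (Polynomial A)ᵐᵒᵖ) :
    motive r := by
  obtain ⟨q, rfl⟩ := op_surjective r
  induction q using Polynomial.induction_on with
  | C a => exact hC a
  | add p q hp hq => simpa using hadd _ _ hp hq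
  | monomial n a h =>
    rw [pow_succ, ← mul_assoc, op_mul]
    exact hmul _ _ hX h

/-- An additive map between right `A[X]`-modules commuting with the action of constants and of `X`
is `A[X]`-linear. -/
def opPolynomialLinearMapOfAddMonoidHom {A P Q : Type*} [Ring A] [AddCommGroup P]
    [Module (Polynomial A)ᵐᵒᵖ P] [AddCommGroup Q] [Module (Polynomial A)ᵐᵒᵖ Q] (F : P →+ Q)
    (hC : ∀ (a : A) (p : P), F (op (Polynomial.C a) • p) = op (Polynomial.C a) • F p)
    (hX : ∀ p : P, F (op (Polynomial.X : Polynomial A) • p) =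
      op (Polynomial.X : Polynomial A) • F p) :
    P →ₗ[(Polynomial A)ᵐᵒᵖ] Q where
  __ := F
  map_smul' r := by
    change ∀ p, F (r • p) = r • F p
    induction r using op_polynomial_induction with
    | hC a => exact hC a
    | hX => exact hX
    | hadd r s hr hs => intro p; rw [add_smul, map_add, hr, hs, add_smul]
    | hmul r s hr hs => intro p; rw [mul_smul, hr, hs, mul_smul]

/-- The submodule `N[X]` of the polynomial module `M[X]`. -/
def polynomialSubmodule {A M P : Type*} [Ring A] [AddCommGroup M] [Module Aᵐᵒᵖ M]
    [AddCommGroup P] [Module (Polynomial A)ᵐᵒᵖ P]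
    (e : P ≃+ (ℕ →₀ M))
    (hC : ∀ (p : P) (a : A),
      e (op (Polynomial.C a) • p) = (e p).mapRange (fun m => op a • m) (smul_zero _))
    (hX : ∀ p : P,
      e (op (Polynomial.X : Polynomial A) • p) = Finsupp.mapDomain (· + 1) (e p))
    (N : Submodule Aᵐᵒᵖ M) : Submodule (Polynomial A)ᵐᵒᵖ P where
  carrier := {p | ∀ n, e p n ∈ N}
  zero_mem' n := by simp
  add_mem' hp hq n := by
    rw [map_add]
    exact N.add_mem (hp n) (hq n)
  smul_mem' r := by
    change ∀ p, (∀ n, e p n ∈ N) → ∀ n, e (r • p) n ∈ N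
    induction r using op_polynomial_induction with
    | hC a =>
      intro p hp n
      rw [hC, Finsupp.mapRange_apply]
      exact N.smul_mem _ (hp n)
    | hX =>
      intro p hp n
      rw [hX]
      cases n with
      | zero =>
        rw [Finsupp.mapDomain_of_notMem_range _ _ (by simp)]
        exact N.zero_mem
      | succ n =>
        rw [Finsupp.mapDomain_apply (add_left_injective 1)]
        exact hp n
    | hadd r s hr hs =>
      intro p hp n
      rw [add_smul, map_add]
      exact N.add_mem (hr p hp n) (hs p hp n)
    | hmul r s hr hs =>
      intro p hp n
      rw [mul_smul]
      exact hr _ (hs p hp) n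

/-- If the polynomial module `M[X]` is a bassian right `A[X]`-module, then `M` is a
bassian right `A`-module. Here `M[X]` is realized as a right `A[X]`-module `P` together
with an additive identification of `P` with `ℕ →₀ M` (polynomials with coefficients in
`M`) under which the action of the constant `C a` is coefficientwise right
multiplication by `a` and the action of `X` is the shift of coefficients. -/
theorem stmt19 {A M P : Type*} [Ring A] [AddCommGroup M] [Module Aᵐᵒᵖ M]
    [AddCommGroup P] [Module (Polynomial A)ᵐᵒᵖ P]
    (e : P ≃+ (ℕ →₀ M))
    (hC : ∀ (p : P) (a : A),
      e (op (Polynomial.C a) • p) = (e p).mapRange (fun m => op a • m) (smul_zero _))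
    (hX : ∀ p : P,
      e (op (Polynomial.X : Polynomial A) • p) = Finsupp.mapDomain (· + 1) (e p))
    (hP : IsBassian (Polynomial A)ᵐᵒᵖ P) :
    IsBassian Aᵐᵒᵖ M := by
  rintro N ⟨f, hf⟩
  obtain ⟨g, hg0, hg⟩ : ∃ g : M → M, g 0 = 0 ∧ ∀ m, N.mkQ (g m) = f m := by
    classical
    choose s hs using N.mkQ_surjective
    refine ⟨Function.update (fun m => s (f m)) 0 0, by simp, fun m => ?_⟩
    by_cases hm : m = 0
    · simp [hm]
    · simp [hm, hs]
  let K := polynomialSubmodule e hC hX N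
  let G : P → P := fun p => e.symm ((e p).mapRange g hg0)
  have hG : ∀ p n, N.mkQ (e (G p) n) = f (e p n) := fun p n => by simp [G, ← hg]
  have mkQ_eq : ∀ p q, (∀ n, N.mkQ (e p n) = N.mkQ (e q n)) → K.mkQ p = K.mkQ q := by
    intro p q h
    refine (Submodule.Quotient.eq K).2 fun n => ?_
    rw [map_sub]
    exact (Submodule.Quotient.eq N).1 (h n)
  let F : P →+ P ⧸ K := AddMonoidHom.mk' (fun p => K.mkQ (G p)) fun p q => by
    rw [← map_add]
    refine mkQ_eq _ _ fun n => ?_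
    rw [hG, map_add, map_add, Finsupp.add_apply, Finsupp.add_apply, map_add, map_add, hG, hG]
  let L := opPolynomialLinearMapOfAddMonoidHom F
    (fun (a : A) p => by
      change K.mkQ (G _) = op (Polynomial.C (R := A) a) • K.mkQ (G p)
      rw [← map_smul]
      refine mkQ_eq _ _ fun n => ?_
      rw [hG, hC, hC, Finsupp.mapRange_apply, Finsupp.mapRange_apply, map_smul, map_smul, hG])
    (fun p => by
      change K.mkQ (G _) = op (Polynomial.X : Polynomial A) • K.mkQ (G p)
      rw [← map_smul]
      refine mkQ_eq _ _ fun n => ?_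
      rw [hG, hX, hX]
      cases n with
      | zero =>
        rw [Finsupp.mapDomain_of_notMem_range _ _ (by simp),
          Finsupp.mapDomain_of_notMem_range _ _ (by simp), map_zero, map_zero]
      | succ n =>
        rw [Finsupp.mapDomain_apply (add_left_injective 1),
          Finsupp.mapDomain_apply (add_left_injective 1), hG])
  have hL : Function.Injective L := by
    refine (injective_iff_map_eq_zero L).2 fun p hp => ?_
    have hGp : G p ∈ K := (Submodule.Quotient.mk_eq_zero K).1 hp
    refine (map_eq_zero_iff e e.injective).1 (Finsupp.ext fun n => hf ?_)
    rw [← hG, Finsupp.zero_apply, map_zero]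
    exact (Submodule.Quotient.mk_eq_zero N).2 (hGp n)
  have hbot : K = ⊥ := hP K ⟨L, hL⟩
  refine (Submodule.eq_bot_iff N).2 fun m hm => ?_
  have hmem : e.symm (Finsupp.single 0 m) ∈ K := by
    intro n
    rw [e.apply_symm_apply, Finsupp.single_apply]
    split_ifs
    exacts [hm, N.zero_mem]
  rw [hbot, Submodule.mem_bot] at hmem
  simpa using hmem
end
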